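/- arXiv:2006.03090 — 6 statements merged into one kernel-verified Lean document; each statement's English description precedes it below -/
import Mathlib

section
/- Suppose b₁ > 0 and 3b₁ + b₂ < 0. Then b₁ - b₂ > 0, the number β₀ := √(-(b₁-b₂)(3b₁+b₂)) / (2(b₁-b₂)) lies in (0, 1/2), and the set of zeros of φ(p) = b₁p(1-p)⁴ + b₂p²(1-p)³ - b₂p³(1-p)² - b₁p⁴(1-p) in the interval [0,1] is exactly {0, 1/2 - β₀, 1/2, 1/2 + β₀, 1}. -/
/-- Under assumption (A1) (`b₁ > 0` and `3b₁ + b₂ < 0`, i.e. Region 2), one has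
`b₁ - b₂ > 0`, the quantity `β₀ = √(-(b₁-b₂)(3b₁+b₂)) / (2(b₁-b₂))` lies in `(0, 1/2)`,
and the zeros of the quintic reaction term `φ` in `[0,1]` are exactly
`{0, 1/2 - β₀, 1/2, 1/2 + β₀, 1}`. -/
theorem nlv_roots (b₁ b₂ : ℝ) (hb₁ : 0 < b₁) (hA1 : 3 * b₁ + b₂ < 0) (φ : ℝ → ℝ)
    (hφ : ∀ p, φ p = b₁ * p * (1 - p)^4 + b₂ * p^2 * (1 - p)^3
      - b₂ * p^3 * (1 - p)^2 - b₁ * p^4 * (1 - p)) :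
    0 < b₁ - b₂ ∧
    Real.sqrt (-((b₁ - b₂) * (3 * b₁ + b₂))) / (2 * (b₁ - b₂)) ∈ Set.Ioo (0:ℝ) (1/2) ∧
    {p ∈ Set.Icc (0:ℝ) 1 | φ p = 0} =
      ({0, 1/2 - Real.sqrt (-((b₁ - b₂) * (3 * b₁ + b₂))) / (2 * (b₁ - b₂)), 1/2,
        1/2 + Real.sqrt (-((b₁ - b₂) * (3 * b₁ + b₂))) / (2 * (b₁ - b₂)), 1} : Set ℝ) := by
  have hd : 0 < b₁ - b₂ := by linarith
  set β := Real.sqrt (-((b₁ - b₂) * (3 * b₁ + b₂))) / (2 * (b₁ - b₂)) with hβ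
  have hrad : 0 < -((b₁ - b₂) * (3 * b₁ + b₂)) := neg_pos.mpr (mul_neg_of_pos_of_neg hd hA1)
  have hβ_pos : 0 < β := div_pos (Real.sqrt_pos.mpr hrad) (by linarith)
  have hβ_sq : 4 * (b₁ - b₂) * β ^ 2 = -(3 * b₁ + b₂) := by
    rw [hβ, div_pow, Real.sq_sqrt hrad.le]
    field_simp
    ring
  have hβ_lt : β < 1 / 2 := by
    by_contra! h
    nlinarith [mul_nonneg hd.le (mul_nonneg (sub_nonneg.mpr h) (by linarith : 0 ≤ β + 1 / 2))]
  have hfactor (p : ℝ) : φ p =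
      (b₁ - b₂) * (p * (p - (1 / 2 - β)) * (1 - 2 * p) * (p - (1 / 2 + β)) * (1 - p)) := by
    rw [hφ]
    linear_combination (p * (1 - p) * (1 - 2 * p) / 4) * hβ_sq
  refine ⟨hd, ⟨hβ_pos, hβ_lt⟩, ?_⟩
  ext p
  simp only [Set.mem_ofPred_eq, Set.mem_Icc, Set.mem_insert_iff, Set.mem_singleton_iff, hfactor,
    mul_eq_zero, hd.ne', false_or]
  constructor
  · rintro ⟨-, (((h | h) | h) | h) | h⟩
    · exact Or.inl h
    · exact Or.inr (Or.inl (by linarith))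
    · exact Or.inr (Or.inr (Or.inl (by linarith)))
    · exact Or.inr (Or.inr (Or.inr (Or.inl (by linarith))))
    · exact Or.inr (Or.inr (Or.inr (Or.inr (by linarith))))
  · rintro (rfl | rfl | rfl | rfl | rfl) <;>
      exact ⟨⟨by linarith, by linarith⟩, by norm_num⟩
end

section
/- Suppose b₁ > 0 and 3b₁ + b₂ < 0, and set β₀ := √(-(b₁-b₂)(3b₁+b₂)) / (2(b₁-b₂)). Then the second derivative of φ(p) = b₁p(1-p)⁴ + b₂p²(1-p)³ - b₂p³(1-p)² - b₁p⁴(1-p) at the root 1/2 + β₀ equals φ''(1/2 + β₀) = -4β₀(6b₁ + b₂); in particular, if additionally 6b₁ + b₂ > 0 then φ''(1/2 + β₀) < 0. -/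
/-- The second derivative of an odd quintic centred at `c`. -/
theorem deriv_deriv_odd_quintic (a₁ a₃ a₅ c x : ℝ) :
    deriv (deriv fun p : ℝ => a₁ * (p - c) + a₃ * (p - c) ^ 3 + a₅ * (p - c) ^ 5) x =
      6 * a₃ * (x - c) + 20 * a₅ * (x - c) ^ 3 := by
  have hsub (p : ℝ) : HasDerivAt (fun p : ℝ => p - c) 1 p := (hasDerivAt_id p).sub_const c
  have hfirst : (deriv fun p : ℝ => a₁ * (p - c) + a₃ * (p - c) ^ 3 + a₅ * (p - c) ^ 5) =
      fun p => a₁ + 3 * a₃ * (p - c) ^ 2 + 5 * a₅ * (p - c) ^ 4 := by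
    funext p
    refine (((((hsub p).const_mul a₁).add (((hsub p).pow 3).const_mul a₃)).add
      (((hsub p).pow 5).const_mul a₅)).congr_deriv ?_).deriv
    norm_num
    ring
  rw [hfirst]
  refine ((((((hsub x).pow 2).const_mul (3 * a₃)).const_add a₁).add
    (((hsub x).pow 4).const_mul (5 * a₅))).congr_deriv ?_).deriv
  norm_num
  ring

/-- Under assumption (A1) (`b₁ > 0`, `3b₁ + b₂ < 0`), with
`β₀ = √(-(b₁-b₂)(3b₁+b₂)) / (2(b₁-b₂))`, the second derivative of the quintic
reaction term at the root `1/2 + β₀` equals `-4β₀(6b₁+b₂)`; in particular it is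
negative under assumption (A3) (`6b₁ + b₂ > 0`). -/
theorem nlv_second_deriv_at_root (b₁ b₂ : ℝ) (hb₁ : 0 < b₁) (hA1 : 3 * b₁ + b₂ < 0)
    (φ : ℝ → ℝ)
    (hφ : ∀ p, φ p = b₁ * p * (1 - p)^4 + b₂ * p^2 * (1 - p)^3
      - b₂ * p^3 * (1 - p)^2 - b₁ * p^4 * (1 - p))
    (β₀ : ℝ) (hβ₀ : β₀ = Real.sqrt (-((b₁ - b₂) * (3 * b₁ + b₂))) / (2 * (b₁ - b₂))) :
    deriv (deriv φ) (1/2 + β₀) = -4 * β₀ * (6 * b₁ + b₂) ∧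
    (0 < 6 * b₁ + b₂ → deriv (deriv φ) (1/2 + β₀) < 0) := by
  have hB : 0 < b₁ - b₂ := by linarith
  have hD : 0 < -((b₁ - b₂) * (3 * b₁ + b₂)) := neg_pos.2 (mul_neg_of_pos_of_neg hB hA1)
  have hβ_pos : 0 < β₀ := by
    rw [hβ₀]
    positivity
  have hβ_sq : 4 * (b₁ - b₂) * β₀ ^ 2 = -(3 * b₁ + b₂) := by
    rw [hβ₀, div_pow, Real.sq_sqrt hD.le]
    field_simp
    ring
  have hφ_odd : φ = fun p => -((3 * b₁ + b₂) / 8) * (p - 1 / 2) +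
      (b₁ + b₂) * (p - 1 / 2) ^ 3 + 2 * (b₁ - b₂) * (p - 1 / 2) ^ 5 := by
    funext p
    rw [hφ]
    ring
  have hderiv : deriv (deriv φ) (1/2 + β₀) = -4 * β₀ * (6 * b₁ + b₂) := by
    rw [hφ_odd, deriv_deriv_odd_quintic]
    linear_combination 10 * β₀ * hβ_sq
  refine ⟨hderiv, fun hA3 => ?_⟩
  rw [hderiv]
  linarith [mul_pos hβ_pos hA3]
end

section
/- Let g : [0,1] → [0,1] be continuous and strictly increasing, with fixed points u₋ < u₀ < u₊ satisfying u₋ + u₊ = 2u₀ and no other fixed points in (u₋, u₊), differentiable at u₀ with g'(u₀) > 1, satisfying the antisymmetry g(u₊ - δ) + g(u₋ + δ) = 2u₀ for all δ ∈ [0, u₊ - u₋], and satisfying condition (G4): there exist c₀ ∈ (0,1) and δ₀ > 0 such that u₊ - g(u₊ - δ) = g(u₋ + δ) - u₋ ≤ (1 - c₀)δ whenever 0 ≤ δ ≤ δ₀. Then for every k ∈ ℕ there exists A(k) < ∞ such that for all ε ∈ (0, u₊ - u₀] and all n ≥ A(k)·|log ε|, the n-th iterate satisfies g⁽ⁿ⁾(u₀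 + ε) ≥ u₊ - εᵏ and g⁽ⁿ⁾(u₀ - ε) ≤ u₋ + εᵏ. -/
open Set Filter Topology

/-- A continuous map with no fixed point inside `(a, b)`, expanding at its fixed point `a` and
contracting towards `b`, moves points of `[a, b]` up by at least a multiple of
`(x - a) * (b - x)`. -/
theorem exists_pos_mul_le_sub_self {g : ℝ → ℝ} {a b g' c d : ℝ} (hab : a < b) (hab1 : b - a ≤ 1)
    (hcont : ContinuousOn g (Icc a b)) (ha : g a = a)
    (hne : ∀ x ∈ Ioo a b, g x ≠ x) (hderiv : HasDerivAt g g' a) (hg' : 1 < g')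
    (hc : 0 < c) (hd : 0 < d)
    (hcontr : ∀ x ∈ Icc a b, b - d ≤ x → c * (b - x) ≤ g x - x) :
    ∃ q > 0, ∀ x ∈ Icc a b, q * ((x - a) * (b - x)) ≤ g x - x := by
  obtain ⟨r, hr1, hrg⟩ := exists_between hg'
  have hslope : ∀ᶠ x in 𝓝[>] a, r < slope g a x :=
    (hderiv.tendsto_slope.mono_left
      (nhdsWithin_mono _ fun _ hx => ne_of_gt hx)).eventually_const_lt hrg
  obtain ⟨u, hau, hu⟩ := mem_nhdsGT_iff_exists_Ioo_subset.1 hslope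
  have hau : a < u := hau
  have hexp : ∀ x ∈ Ioo a u, (r - 1) * (x - a) ≤ g x - x := by
    intro x hx
    have h : r < slope g a x := hu hx
    rw [slope_def_field, ha, lt_div_iff₀ (sub_pos.2 hx.1)] at h
    linarith
  have hpos : ∀ x ∈ Ioo a b, 0 < g x - x := by
    intro x hx
    by_contra! hneg
    obtain ⟨y, hay, hyu⟩ := exists_between (lt_min hau hx.1)
    have hy : 0 < g y - y := lt_of_lt_of_le
      (mul_pos (sub_pos.2 hr1) (sub_pos.2 hay)) (hexp y ⟨hay, hyu.trans_le (min_le_left _ _)⟩)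
    have hyx : y ≤ x := (hyu.trans_le (min_le_right _ _)).le
    have hsub : Icc y x ⊆ Icc a b := Icc_subset_Icc hay.le hx.2.le
    obtain ⟨z, hz, hz0⟩ := intermediate_value_Icc' hyx
      ((hcont.mono hsub).sub continuousOn_id) ⟨hneg, hy.le⟩
    exact hne z ⟨hay.trans_le hz.1, hz.2.trans_lt hx.2⟩ (sub_eq_zero.1 hz0)
  obtain ⟨s, has, hsu⟩ := exists_between (lt_min hau hab)
  obtain ⟨t, hts, htb⟩ := exists_between (max_lt (sub_lt_self b hd) hab)
  have hst : Icc s t ⊆ Ioo a b := fun x hx => ⟨has.trans_le hx.1, hx.2.trans_lt htb⟩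
  obtain ⟨m, hm, hmid⟩ : ∃ m > 0, ∀ x ∈ Icc s t, m ≤ g x - x :=
    isCompact_Icc.exists_forall_le' (f := fun x => g x - x)
      ((hcont.mono (hst.trans Ioo_subset_Icc_self)).sub continuousOn_id)
      fun x hx => hpos x (hst hx)
  refine ⟨min (r - 1) (min c m), lt_min (sub_pos.2 hr1) (lt_min hc hm), fun x hx => ?_⟩
  have hxa := sub_nonneg.2 hx.1
  have hxb := sub_nonneg.2 hx.2
  have hxa1 : x - a ≤ 1 := by linarith [hx.2]
  have hxb1 : b - x ≤ 1 := by linarith [hx.1]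
  have hxx := mul_nonneg hxa hxb
  rcases hx.1.eq_or_lt with rfl | hax
  · simp [ha]
  rcases lt_or_ge x s with hxs | hsx
  · calc _ ≤ (r - 1) * (x - a) := mul_le_mul (min_le_left _ _)
          (mul_le_of_le_one_right hxa hxb1) hxx (sub_pos.2 hr1).le
      _ ≤ _ := hexp x ⟨hax, hxs.trans (hsu.trans_le (min_le_left _ _))⟩
  rcases lt_or_ge t x with htx | hxt
  · calc _ ≤ c * (b - x) := mul_le_mul ((min_le_right _ _).trans (min_le_left _ _))
          (mul_le_of_le_one_left hxb hxa1) hxx hc.le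
      _ ≤ _ := hcontr x hx ((le_max_left _ _).trans (hts.trans htx).le)
  · calc _ ≤ m * 1 := mul_le_mul ((min_le_right _ _).trans (min_le_right _ _))
          (mul_le_one₀ hxa1 hxb hxb1) hxx hm.le
      _ ≤ _ := by simpa using hmid x ⟨hsx, hxt⟩

/-- If `g` increases the ratio `(x - a) / (b - x)` by a factor `l` on `[a, b)`, then its `n`-th
iterate increases it by a factor `l ^ n`. -/
theorem pow_mul_ratio_le_iterate {g : ℝ → ℝ} {a b l : ℝ} (hl : 0 ≤ l)
    (hmaps : MapsTo g (Ico a b) (Ico a b))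
    (hstep : ∀ x ∈ Ico a b, l * ((x - a) * (b - g x)) ≤ (g x - a) * (b - x))
    {x : ℝ} (hx : x ∈ Ico a b) (n : ℕ) :
    l ^ n * ((x - a) * (b - g^[n] x)) ≤ (g^[n] x - a) * (b - x) := by
  induction n with
  | zero => simp
  | succ n ih =>
    have hy := hmaps.iterate n hx
    rw [Function.iterate_succ_apply']
    generalize g^[n] x = y at *
    have hy' := hmaps hy
    have h₁ := mul_le_mul_of_nonneg_left ih (mul_nonneg hl (sub_nonneg.2 hy'.2.le))
    have h₂ := mul_le_mul_of_nonneg_right (hstep y hy) (sub_nonneg.2 hx.2.le)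
    refine le_of_mul_le_mul_right ?_ (sub_pos.2 hy.2)
    rw [pow_succ]
    linarith


/-- Lemma 2.8 of the paper: if the voting function `g` satisfies (G0)--(G4), then for
every `k` there is `A(k) < ∞` such that for all `ε ∈ (0, u₊ - u₀]` and
`n ≥ A(k)|log ε|`, the iterates satisfy `g⁽ⁿ⁾(u₀+ε) ≥ u₊ - εᵏ` and
`g⁽ⁿ⁾(u₀-ε) ≤ u₋ + εᵏ`. -/
theorem iterates_converge (g : ℝ → ℝ) (um u0 up : ℝ)
    (humem : um ∈ Set.Icc (0:ℝ) 1) (hupmem : up ∈ Set.Icc (0:ℝ) 1)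
    (h₁ : um < u0) (h₂ : u0 < up) (hsum : um + up = 2 * u0)
    (hcont : ContinuousOn g (Set.Icc 0 1))
    (hmono : StrictMonoOn g (Set.Icc 0 1))
    (hmaps : Set.MapsTo g (Set.Icc 0 1) (Set.Icc 0 1))
    (hfixm : g um = um) (hfix0 : g u0 = u0) (hfixp : g up = up)
    (honly : ∀ p ∈ Set.Ioo um up, g p = p → p = u0)
    (hderiv : ∃ g' : ℝ, HasDerivAt g g' u0 ∧ 1 < g')
    (hsym : ∀ δ ∈ Set.Icc (0:ℝ) (up - um), g (up - δ) + g (um + δ) = 2 * u0)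
    (hG4 : ∃ c₀ ∈ Set.Ioo (0:ℝ) 1, ∃ δ₀ > (0:ℝ), ∀ δ : ℝ, 0 ≤ δ → δ ≤ δ₀ →
      up - g (up - δ) = g (um + δ) - um ∧ up - g (up - δ) ≤ (1 - c₀) * δ) :
    ∀ k : ℕ, ∃ A : ℝ, ∀ ε ∈ Set.Ioc (0:ℝ) (up - u0), ∀ n : ℕ,
      A * |Real.log ε| ≤ (n : ℝ) →
      up - ε ^ k ≤ g^[n] (u0 + ε) ∧ g^[n] (u0 - ε) ≤ um + ε ^ k := by
  obtain ⟨g', hg, hg'⟩ := hderiv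
  obtain ⟨c, hc, d, hd, hG⟩ := hG4
  have hsub : Icc u0 up ⊆ Icc 0 1 := Icc_subset_Icc (humem.1.trans h₁.le) hupmem.2
  have hL : up - u0 ≤ 1 / 2 := by linarith [humem.1, hupmem.2]
  obtain ⟨q, hq, hgrow⟩ := exists_pos_mul_le_sub_self (c := c) h₂ (by linarith)
    (hcont.mono hsub) hfix0
    (fun x hx hxx => hx.1.ne' (honly x ⟨h₁.trans hx.1, hx.2⟩ hxx)) hg hg' hc.1 hd
    (fun x hx hdx => by
      have h := (hG (up - x) (by linarith [hx.2]) (by linarith)).2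
      rw [sub_sub_cancel] at h
      linarith)
  have hle : ∀ x ∈ Icc u0 up, x ≤ g x := fun x hx => by
    have := mul_nonneg hq.le (mul_nonneg (sub_nonneg.2 hx.1) (sub_nonneg.2 hx.2))
    linarith [hgrow x hx]
  have hmapsIco : MapsTo g (Ico u0 up) (Ico u0 up) := fun x hx =>
    ⟨hx.1.trans (hle x (Ico_subset_Icc_self hx)),
      (hmono (hsub (Ico_subset_Icc_self hx)) hupmem hx.2).trans_eq hfixp⟩
  set l := 1 + q * (up - u0) with hl
  have hl1 : 1 < l := by linarith [mul_pos hq (sub_pos.2 h₂)]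
  have hstep : ∀ x ∈ Ico u0 up, l * ((x - u0) * (up - g x)) ≤ (g x - u0) * (up - x) := by
    intro x hx
    have hx' := Ico_subset_Icc_self hx
    have h₃ : q * ((x - u0) * (up - g x)) ≤ q * ((x - u0) * (up - x)) :=
      mul_le_mul_of_nonneg_left (mul_le_mul_of_nonneg_left (by linarith [hle x hx'])
        (sub_nonneg.2 hx.1)) hq.le
    have h₄ := mul_le_mul_of_nonneg_right (h₃.trans (hgrow x hx')) (sub_pos.2 h₂).le
    rw [hl]
    linarith
  have hreflect : ∀ x ∈ Icc u0 up, ∀ n, g^[n] (2 * u0 - x) = 2 * u0 - g^[n] x := by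
    have hmapsIcc : MapsTo g (Icc u0 up) (Icc u0 up) := fun x hx =>
      ⟨hx.1.trans (hle x hx), (hmono.monotoneOn (hsub hx) hupmem hx.2).trans_eq hfixp⟩
    intro x hx n
    induction n with
    | zero => rfl
    | succ n ih =>
      rw [Function.iterate_succ_apply', Function.iterate_succ_apply', ih]
      have hy := hmapsIcc.iterate n hx
      have h := hsym (up - g^[n] x) ⟨by linarith [hy.2], by linarith [hy.1]⟩
      rw [sub_sub_cancel, show um + (up - g^[n] x) = 2 * u0 - g^[n] x by linarith] at h
      linarith
  intro k
  refine ⟨(k + 1) / Real.log l, fun ε hε n hn => ?_⟩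
  have hx : u0 + ε ∈ Icc u0 up := ⟨by linarith [hε.1], by linarith [hε.2]⟩
  suffices h : up - ε ^ k ≤ g^[n] (u0 + ε) by
    refine ⟨h, ?_⟩
    have := hreflect _ hx n
    rw [show 2 * u0 - (u0 + ε) = u0 - ε by ring] at this
    linarith
  rcases hx.2.eq_or_lt with heq | hlt
  · rw [heq, Function.iterate_fixed hfixp]
    linarith [pow_pos hε.1 k]
  have hpow : 1 ≤ l ^ n * ε ^ (k + 1) := by
    have hl0 : 0 < l := by linarith
    have hε0 := hε.1
    rw [abs_of_neg (Real.log_neg hε0 (by linarith [hε.2])), div_mul_eq_mul_div,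
      div_le_iff₀ (Real.log_pos hl1)] at hn
    rw [← Real.log_nonneg_iff (by positivity), Real.log_mul (by positivity) (by positivity),
      Real.log_pow, Real.log_pow]
    push_cast
    linarith
  have hxI : u0 + ε ∈ Ico u0 up := ⟨hx.1, hlt⟩
  have hratio := pow_mul_ratio_le_iterate (by linarith) hmapsIco hstep hxI n
  have hy := hmapsIco.iterate n hxI
  generalize g^[n] (u0 + ε) = y at *
  have hone : (y - u0) * (up - (u0 + ε)) ≤ 1 :=
    mul_le_one₀ (by linarith [hy.2]) (by linarith) (by linarith [hε.1])
  have hkey : up - y ≤ ε ^ k := by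
    refine le_of_mul_le_mul_left ?_ (mul_pos (pow_pos (zero_lt_one.trans hl1) n) hε.1)
    calc l ^ n * ε * (up - y) = l ^ n * ((u0 + ε - u0) * (up - y)) := by ring
      _ ≤ l ^ n * ε ^ (k + 1) := hratio.trans (hone.trans hpow)
      _ = l ^ n * ε * ε ^ k := by ring
  linarith
end

section
/- Let u₀ < u₊ be reals, let δ₀ ∈ (0, u₊ - u₀), and let g : [0,1] → [0,1] be continuous and nondecreasing with g(p) > p for every p ∈ (u₀, u₊ - δ₀], and differentiable at u₀ with g(u₀) = u₀ and g'(u₀) > 1. Then k₁ := inf{ (g(u₀ + x) - (u₀ + x))/x : x ∈ (0, u₊ - δ₀ - u₀] } > 0, and for every ε ∈ (0, u₊ - δ₀ - u₀] there exists m ∈ ℕ with m ≤ ⌈ log((u₊ - δ₀ - u₀)/ε) / log(1 + k₁) ⌉ + 1 such that the m-th iterate satisfies g⁽ᵐ⁾(u₀ + ε) ≥ u₊ - δ₀. -/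
/-- If `g` has derivative `> 1` at its fixed point `u` and lies above the diagonal on
`(u, u + L]`, then its relative excess over the diagonal is bounded below there. -/
theorem exists_pos_le_relative_excess {g : ℝ → ℝ} {u L g' : ℝ}
    (hcont : ContinuousOn g (Set.Icc u (u + L)))
    (habove : ∀ p ∈ Set.Ioc u (u + L), p < g p)
    (hfix : g u = u) (hderiv : HasDerivAt g g' u) (hg' : 1 < g') :
    ∃ c > 0, ∀ x ∈ Set.Ioc 0 L, c ≤ (g (u + x) - (u + x)) / x := by
  obtain ⟨b, hb1, hb⟩ := exists_between hg'
  have hslope := (hasDerivAt_iff_tendsto_slope_zero.1 hderiv).eventually (lt_mem_nhds hb)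
  rw [eventually_nhdsWithin_iff, Metric.eventually_nhds_iff] at hslope
  obtain ⟨η, hη, hnear⟩ := hslope
  have hcont' : ContinuousOn (fun x => (g (u + x) - (u + x)) / x) (Set.Icc η L) := by
    refine ContinuousOn.div (ContinuousOn.sub (hcont.comp (by fun_prop) ?_) (by fun_prop))
      continuousOn_id fun x hx => (hη.trans_le hx.1).ne'
    intro x hx
    exact ⟨by linarith [hx.1], by linarith [hx.2]⟩
  obtain ⟨a, ha, hfar⟩ := isCompact_Icc.exists_forall_le' hcont' (a := 0) fun x hx => by
    have hx0 : 0 < x := hη.trans_le hx.1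
    exact div_pos (sub_pos.2 (habove _ ⟨by linarith, by linarith [hx.2]⟩)) hx0
  refine ⟨min (b - 1) a, lt_min (by linarith) ha, fun x hx => ?_⟩
  have hx0 : 0 < x := hx.1
  rcases lt_or_ge x η with hxη | hxη
  · refine (min_le_left _ _).trans ?_
    have h := hnear (y := x) (by simpa [abs_of_pos hx0] using hxη) hx0.ne'
    rw [hfix, smul_eq_mul, inv_mul_eq_div, lt_div_iff₀ hx0] at h
    rw [le_div_iff₀ hx0]
    linarith
  · exact (min_le_right _ _).trans (hfar x ⟨hxη, hx.2⟩)

/-- If `g` expands the distance to `u` by a factor `1 + k` on `(u, u + L]`, then an orbit starting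
at `u + ε` either reaches `u + L` within `n` steps or is at distance at least `ε (1 + k) ^ n`
from `u` after `n` steps. -/
theorem iterate_escapes_or_expands {g : ℝ → ℝ} {u L k ε : ℝ} (hk : 0 < k)
    (hexp : ∀ x ∈ Set.Ioc 0 L, (1 + k) * x ≤ g (u + x) - u) (hε : 0 < ε) (n : ℕ) :
    (∃ m ≤ n, u + L ≤ g^[m] (u + ε)) ∨ ε * (1 + k) ^ n ≤ g^[n] (u + ε) - u := by
  induction n with
  | zero => right; simp
  | succ n ih =>
    rcases ih with ⟨m, hm, h⟩ | h
    · exact Or.inl ⟨m, by lia, h⟩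
    · rcases le_or_gt (u + L) (g^[n] (u + ε)) with hL | hL
      · exact Or.inl ⟨n, by lia, hL⟩
      · right
        have hpos : 0 < g^[n] (u + ε) - u := lt_of_lt_of_le (by positivity) h
        have hstep := hexp _ ⟨hpos, by linarith⟩
        rw [add_sub_cancel] at hstep
        rw [Function.iterate_succ_apply', pow_succ]
        calc ε * ((1 + k) ^ n * (1 + k)) = (1 + k) * (ε * (1 + k) ^ n) := by ring
          _ ≤ (1 + k) * (g^[n] (u + ε) - u) := by gcongr
          _ ≤ _ := hstep

/-- Escape estimate from the unstable fixed point `u₀` (proof of Lemma 2.8): with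
`k₁ = inf { (g(u₀+x) - (u₀+x))/x : x ∈ (0, u₊-δ₀-u₀] } > 0`, starting at `u₀ + ε`
at most `⌈log((u₊-δ₀-u₀)/ε)/log(1+k₁)⌉ + 1` iterations of `g` reach `u₊ - δ₀`. -/
theorem iterates_escape (g : ℝ → ℝ) (u0 up δ₀ : ℝ)
    (hu0 : 0 ≤ u0) (hup : up ≤ 1) (hlt : u0 < up)
    (hδ₀ : δ₀ ∈ Set.Ioo (0:ℝ) (up - u0))
    (hcont : ContinuousOn g (Set.Icc 0 1))
    (hmono : MonotoneOn g (Set.Icc 0 1))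
    (hmaps : Set.MapsTo g (Set.Icc 0 1) (Set.Icc 0 1))
    (habove : ∀ p ∈ Set.Ioc u0 (up - δ₀), p < g p)
    (hfix : g u0 = u0)
    (hderiv : ∃ g' : ℝ, HasDerivAt g g' u0 ∧ 1 < g') :
    0 < sInf ((fun x => (g (u0 + x) - (u0 + x)) / x) '' Set.Ioc 0 (up - δ₀ - u0)) ∧
    ∀ ε ∈ Set.Ioc (0:ℝ) (up - δ₀ - u0), ∃ m : ℕ,
      m ≤ ⌈Real.log ((up - δ₀ - u0) / ε) /
            Real.log (1 + sInf ((fun x => (g (u0 + x) - (u0 + x)) / x) ''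
              Set.Ioc 0 (up - δ₀ - u0)))⌉₊ + 1 ∧
      up - δ₀ ≤ g^[m] (u0 + ε) := by
  obtain ⟨g', hg', hg'1⟩ := hderiv
  have hδ := hδ₀.1
  have hδ' := hδ₀.2
  set L := up - δ₀ - u0 with hL
  have hL0 : 0 < L := by linarith
  have hup' : up - δ₀ = u0 + L := by linarith
  rw [hup'] at habove ⊢
  obtain ⟨c, hc, hle⟩ := exists_pos_le_relative_excess
    (hcont.mono (Set.Icc_subset_Icc hu0 (by linarith))) habove hfix hg' hg'1
  set S := (fun x => (g (u0 + x) - (u0 + x)) / x) '' Set.Ioc 0 L with hS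
  have hlower : c ∈ lowerBounds S := by
    rintro _ ⟨x, hx, rfl⟩
    exact hle x hx
  have hne : S.Nonempty := (Set.nonempty_Ioc.2 hL0).image _
  have hk : 0 < sInf S := hc.trans_le (le_csInf hne hlower)
  refine ⟨hk, fun ε hε => ?_⟩
  have hε0 : 0 < ε := hε.1
  have hexp : ∀ x ∈ Set.Ioc 0 L, (1 + sInf S) * x ≤ g (u0 + x) - u0 := by
    intro x hx
    have h : sInf S ≤ (g (u0 + x) - (u0 + x)) / x :=
      csInf_le ⟨c, hlower⟩ (Set.mem_image_of_mem _ hx)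
    rw [le_div_iff₀ hx.1] at h
    linarith
  set n := ⌈Real.log (L / ε) / Real.log (1 + sInf S)⌉₊ with hn
  rcases iterate_escapes_or_expands hk hexp hε0 n with ⟨m, hm, h⟩ | h
  · exact ⟨m, by lia, h⟩
  · refine ⟨n, by lia, ?_⟩
    have hlog : 0 < Real.log (1 + sInf S) := Real.log_pos (by linarith)
    have hceil : Real.log (L / ε) ≤ n * Real.log (1 + sInf S) :=
      (div_le_iff₀ hlog).1 (Nat.le_ceil _)
    rw [← Real.log_pow, Real.log_le_log_iff (by positivity) (by positivity),
      div_le_iff₀ hε0] at hceil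
    linarith
end

section
/- Let u₊ ∈ (0,1) and let g : [0,1] → [0,1] be continuous and nondecreasing with g(u₊) = u₊, g(p) < p for every p ∈ (u₊, 1], and differentiable at u₊ with g'(u₊) < 1. Then k₂ := inf{ ((u₊ + x) - g(u₊ + x))/x : x ∈ (0, 1 - u₊] } satisfies k₂ ∈ (0,1], and for every n ∈ ℕ and δ ∈ [0, 1 - u₊], the n-th iterate satisfies g⁽ⁿ⁾(u₊ + δ) - u₊ ≤ (1 - k₂)ⁿ · δ. -/
open Set in
/-- If `g` lies strictly below the diagonal on `(a, b]`, is continuous on `[a, b]`, and has slope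
less than `1` at its fixed point `a`, then the relative displacement `((a + x) - g (a + x)) / x` is
bounded below by a positive constant on `(0, b - a]`. -/
theorem exists_pos_le_relative_displacement {g : ℝ → ℝ} {a b g' : ℝ}
    (hcont : ContinuousOn g (Icc a b)) (hfix : g a = a) (hbelow : ∀ p ∈ Ioc a b, g p < p)
    (hderiv : HasDerivWithinAt g g' (Ioi a) a) (hg' : g' < 1) :
    ∃ c > 0, ∀ x ∈ Ioc 0 (b - a), c ≤ ((a + x) - g (a + x)) / x := by
  obtain ⟨r, hr, hr1⟩ := exists_between hg'
  obtain ⟨u, hu, hsub⟩ := mem_nhdsGT_iff_exists_Ioo_subset.1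
    (hderiv.limsup_slope_le' self_notMem_Ioi hr)
  have hu : a < u := hu
  have hnear : ∀ x, 0 < x → x < u - a → 1 - r ≤ ((a + x) - g (a + x)) / x := by
    intro x hx hxu
    have h : slope g a (a + x) < r := hsub ⟨by linarith, by linarith⟩
    rw [slope_def_field, hfix, add_sub_cancel_left, div_lt_iff₀ hx] at h
    rw [le_div_iff₀ hx]
    linarith
  have hcontF : ContinuousOn (fun x => ((a + x) - g (a + x)) / x) (Icc (u - a) (b - a)) := by
    refine ContinuousOn.div (ContinuousOn.sub (by fun_prop) (hcont.comp (by fun_prop) ?_))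
      continuousOn_id ?_
    · intro x hx
      constructor <;> linarith [hx.1, hx.2]
    · intro x hx
      exact ne_of_gt (show (0 : ℝ) < x by linarith [hx.1])
  rcases le_or_gt (u - a) (b - a) with hub | hub
  · obtain ⟨m, hm, hmin⟩ := isCompact_Icc.exists_isMinOn (nonempty_Icc.2 hub) hcontF
    have hm0 : 0 < m := by linarith [hm.1]
    have hpos : 0 < ((a + m) - g (a + m)) / m :=
      div_pos (sub_pos.2 (hbelow _ ⟨by linarith, by linarith [hm.2]⟩)) hm0
    refine ⟨min (1 - r) (((a + m) - g (a + m)) / m), lt_min (by linarith) hpos, fun x hx => ?_⟩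
    rcases lt_or_ge x (u - a) with h | h
    · exact (min_le_left _ _).trans (hnear x hx.1 h)
    · exact (min_le_right _ _).trans (hmin ⟨h, hx.2⟩)
  · exact ⟨1 - r, by linarith, fun x hx => hnear x hx.1 (hx.2.trans_lt hub)⟩

/-- A self-map of `[a, b]` that contracts distances to `a` by a factor `q` has iterates contracting
them by `q ^ n`. -/
theorem iterate_sub_le_pow_mul {g : ℝ → ℝ} {a b q : ℝ} (hq : 0 ≤ q)
    (hmaps : Set.MapsTo g (Set.Icc a b) (Set.Icc a b))
    (hstep : ∀ p ∈ Set.Icc a b, g p - a ≤ q * (p - a)) (n : ℕ) {p : ℝ} (hp : p ∈ Set.Icc a b) :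
    g^[n] p - a ≤ q ^ n * (p - a) := by
  induction n with
  | zero => simp
  | succ n ih =>
    rw [Function.iterate_succ_apply', pow_succ', mul_assoc]
    exact (hstep _ (hmaps.iterate n hp)).trans (mul_le_mul_of_nonneg_left ih hq)

/-- Contraction above the stable fixed point `u₊` (core of Lemma `upden`): with
`k₂ = inf { ((u₊+x) - g(u₊+x))/x : x ∈ (0, 1-u₊] } ∈ (0,1]`, for every `n` and
`δ ∈ [0, 1-u₊]` one has `g⁽ⁿ⁾(u₊+δ) - u₊ ≤ (1-k₂)ⁿ δ`. -/
theorem iterates_contraction_above (g : ℝ → ℝ) (up : ℝ)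
    (hup : up ∈ Set.Ioo (0:ℝ) 1)
    (hcont : ContinuousOn g (Set.Icc 0 1))
    (hmono : MonotoneOn g (Set.Icc 0 1))
    (hmaps : Set.MapsTo g (Set.Icc 0 1) (Set.Icc 0 1))
    (hfix : g up = up)
    (hbelow : ∀ p ∈ Set.Ioc up 1, g p < p)
    (hderiv : ∃ g' : ℝ, HasDerivAt g g' up ∧ g' < 1) :
    sInf ((fun x => ((up + x) - g (up + x)) / x) '' Set.Ioc 0 (1 - up)) ∈
      Set.Ioc (0:ℝ) 1 ∧
    ∀ n : ℕ, ∀ δ ∈ Set.Icc (0:ℝ) (1 - up),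
      g^[n] (up + δ) - up ≤
        (1 - sInf ((fun x => ((up + x) - g (up + x)) / x) '' Set.Ioc 0 (1 - up))) ^ n
          * δ := by
  obtain ⟨hup0, hup1⟩ := hup
  obtain ⟨g', hg, hg'⟩ := hderiv
  obtain ⟨c, hc, hcle⟩ := exists_pos_le_relative_displacement
    (hcont.mono (Set.Icc_subset_Icc_left hup0.le)) hfix hbelow hg.hasDerivWithinAt hg'
  have hmaps' : Set.MapsTo g (Set.Icc up 1) (Set.Icc up 1) := fun p hp =>
    ⟨hfix.symm.le.trans (hmono ⟨hup0.le, hup1.le⟩ ⟨hup0.le.trans hp.1, hp.2⟩ hp.1),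
      (hmaps ⟨hup0.le.trans hp.1, hp.2⟩).2⟩
  set S := (fun x => ((up + x) - g (up + x)) / x) '' Set.Ioc 0 (1 - up)
  have hlb : c ∈ lowerBounds S := by
    rintro _ ⟨x, hx, rfl⟩
    exact hcle x hx
  have hmem : (1 - up) ∈ Set.Ioc 0 (1 - up) := ⟨by linarith, le_rfl⟩
  have hk : ∀ x ∈ Set.Ioc 0 (1 - up), sInf S ≤ ((up + x) - g (up + x)) / x := fun x hx =>
    csInf_le ⟨c, hlb⟩ ⟨x, hx, rfl⟩
  have hk1 : sInf S ≤ 1 := by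
    refine (hk _ hmem).trans ((div_le_one hmem.1).2 ?_)
    have := (hmaps' (x := up + (1 - up)) ⟨by linarith, by linarith⟩).1
    linarith
  refine ⟨⟨hc.trans_le (le_csInf ⟨_, _, hmem, rfl⟩ hlb), hk1⟩, fun n δ hδ => ?_⟩
  have hstep : ∀ p ∈ Set.Icc up 1, g p - up ≤ (1 - sInf S) * (p - up) := by
    intro p hp
    rcases hp.1.eq_or_lt with rfl | hlt
    · simp [hfix]
    · have h := hk (p - up) ⟨by linarith, by linarith [hp.2]⟩
      rw [le_div_iff₀ (by linarith), add_sub_cancel] at h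
      linarith
  have h := iterate_sub_le_pow_mul (by linarith) hmaps' hstep n (p := up + δ)
    ⟨by linarith [hδ.1], by linarith [hδ.2]⟩
  rwa [add_sub_cancel_left] at h
end

section
/- Let F : ℝ → ℝ be nondecreasing and satisfy F(x) - F(x-η) ≥ F(x+η) - F(x) for all x ≥ 0 and η > 0. Suppose 0 ≤ z < w ≤ L and F(L) - F(z) ≥ δ₀/2 for some δ₀ > 0. Then F(w) - F(z) ≥ δ₀·(w - z) / (2·(L + (w - z))); in particular F(w) - F(z) ≥ δ₀·(w - z)/(4L). -/
/-- If the increments of `F` are concave at every nonnegative point, then the increment of `F` over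
`n` consecutive steps of length `h` from `z ≥ 0` is at most `n` times the first one. -/
theorem sub_le_nsmul_sub_of_concave_increments {F : ℝ → ℝ}
    (hconc : ∀ x : ℝ, 0 ≤ x → ∀ η : ℝ, 0 < η → F (x + η) - F x ≤ F x - F (x - η))
    {z h : ℝ} (hz : 0 ≤ z) (hh : 0 < h) (n : ℕ) :
    F (z + n * h) - F z ≤ n * (F (z + h) - F z) := by
  have step (k : ℕ) : F (z + (k + 1) * h) - F (z + k * h) ≤ F (z + h) - F z := by
    induction k with
    | zero => simp
    | succ k ih =>
      have hk := hconc (z + (k + 1) * h) (by positivity) h hh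
      rw [show z + (k + 1) * h + h = z + (k + 1 + 1) * h by ring,
        show z + (k + 1) * h - h = z + k * h by ring] at hk
      push_cast
      exact hk.trans ih
  induction n with
  | zero => simp
  | succ n ih =>
    have hn := step n
    push_cast
    linarith

/-- The telescoping slope estimate of Corollary 3.8: if `F` is nondecreasing with
concave increments on `[0,∞)`, `0 ≤ z < w ≤ L`, and `F(L) - F(z) ≥ δ₀/2`, then
`F(w) - F(z) ≥ δ₀(w-z)/(2(L + (w-z)))`, hence `F(w) - F(z) ≥ δ₀(w-z)/(4L)`. -/
theorem interface_slope (F : ℝ → ℝ) (hmono : Monotone F)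
    (hconc : ∀ x : ℝ, 0 ≤ x → ∀ η : ℝ, 0 < η → F (x + η) - F x ≤ F x - F (x - η))
    (z w L δ₀ : ℝ) (hz : 0 ≤ z) (hzw : z < w) (hwL : w ≤ L) (hδ₀ : 0 < δ₀)
    (hgap : δ₀ / 2 ≤ F L - F z) :
    δ₀ * (w - z) / (2 * (L + (w - z))) ≤ F w - F z ∧
    δ₀ * (w - z) / (4 * L) ≤ F w - F z := by
  have hh : 0 < w - z := sub_pos.2 hzw
  have hL : 0 < L := by linarith
  have hD : 0 ≤ F w - F z := sub_nonneg.2 (hmono hzw.le)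
  obtain ⟨n, hn, hn'⟩ : ∃ n : ℕ, L - z ≤ n * (w - z) ∧ n * (w - z) ≤ L + (w - z) := by
    refine ⟨⌈(L - z) / (w - z)⌉₊, (div_le_iff₀ hh).1 (Nat.le_ceil _), ?_⟩
    have hlt := Nat.ceil_lt_add_one (div_nonneg (by linarith : 0 ≤ L - z) hh.le)
    have hmul := mul_le_mul_of_nonneg_right hlt.le hh.le
    rw [add_mul, div_mul_cancel₀ _ hh.ne'] at hmul
    linarith
  have htel := sub_le_nsmul_sub_of_concave_increments hconc hz hh n
  rw [add_sub_cancel] at htel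
  have hFL : F L ≤ F (z + n * (w - z)) := hmono (by linarith)
  have key : δ₀ * (w - z) / (2 * (L + (w - z))) ≤ F w - F z := by
    rw [div_le_iff₀ (by positivity)]
    have h₁ := mul_le_mul_of_nonneg_right (show δ₀ / 2 ≤ n * (F w - F z) by linarith) hh.le
    have h₂ := mul_le_mul_of_nonneg_right hn' hD
    linarith
  refine ⟨key, le_trans ?_ key⟩
  exact div_le_div_of_nonneg_left (by positivity) (by positivity) (by linarith)
end
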